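/- Let G be a bridgeless cubic graph that is not isomorphic to the Petersen graph and that contains a 2-factor (a spanning 2-regular subgraph) with at most two connected components. Then G has a perfect matching M such that there exists a non-conflicting nowhere-zero Z2×Z2 flow with respect to M. -/

import Mathlib

open scoped Classical

/-- The Klein four-group `Z2 × Z2`. -/
abbrev K4 : Type := ZMod 2 × ZMod 2

/-- `α = (1,0)`. -/
def flowAlpha : K4 := (1, 0)

/-- `β = (0,1)`. -/
def flowBeta : K4 := (0, 1)

/-- A graph is bridgeless if no edge is a bridge, i.e. deleting any single edge
does not increase the number of connected components. -/
def SimpleGraph.Bridgeless {V : Type} (G : SimpleGraph V) : Prop :=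
  ∀ e : Sym2 V, ¬ G.IsBridge e

/-- The complementary 2-factor `G − M`: the spanning subgraph of `G` with
edge set `E(G) \ M`. -/
def compl2Factor {V : Type} (G : SimpleGraph V) (M : G.Subgraph) : SimpleGraph V :=
  G.deleteEdges M.edgeSet

/-- A nowhere-zero `Z2 × Z2` flow with respect to a perfect matching `M`, encoded as a
vertex function: `θ v` is the flow value of the unique `M`-edge `e_v` incident to `v`
(so `θ` is constant on the two endpoints of each matching edge, nonzero everywhere,
and sums to zero over every connected component of `G − M`). -/
def IsNZFlowWrt {V : Type} [Fintype V] (G : SimpleGraph V) (M : G.Subgraph)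
    (θ : V → K4) : Prop :=
  (∀ ⦃u v : V⦄, M.Adj u v → θ u = θ v) ∧
  (∀ v : V, θ v ≠ 0) ∧
  (∀ u : V, ∑ v ∈ Finset.univ.filter (fun w => (compl2Factor G M).Reachable u w), θ v = 0)

/-- `θ` is non-conflicting: there is no edge `uv ∈ E(G) \ M` with
`θ(e_u) = α` and `θ(e_v) = β`. -/
def NonConflicting {V : Type} (G : SimpleGraph V) (M : G.Subgraph) (θ : V → K4) : Prop :=
  ¬ ∃ u v : V, G.Adj u v ∧ ¬ M.Adj u v ∧ θ u = flowAlpha ∧ θ v = flowBeta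

/-- The Petersen graph, as the Kneser graph `K(5,2)`: vertices are the 2-element
subsets of a 5-element set, adjacent exactly when disjoint. -/
def PetersenGraph : SimpleGraph {s : Finset (Fin 5) // s.card = 2} :=
  SimpleGraph.fromRel (fun a b => Disjoint a.1 b.1)

namespace NonConflictingFlow

variable {V : Type}

/-- A perfect matching of `G`, given as the map sending each vertex to its partner. -/
structure IsMate (G : SimpleGraph V) (m : V → V) : Prop where
  invol : ∀ v, m (m v) = v
  adj : ∀ v, G.Adj v (m v)

/-- The 2-factor complementary to the perfect matching given by `m`. -/
def coFactor (G : SimpleGraph V) (m : V → V) : SimpleGraph V where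
  Adj u v := G.Adj u v ∧ v ≠ m u ∧ u ≠ m v
  symm := ⟨fun _ _ h => ⟨h.1.symm, h.2.2, h.2.1⟩⟩
  loopless := ⟨fun _ h => h.1.ne rfl⟩

/-- The perfect matching given by `m`, as a subgraph. -/
def IsMate.toSubgraph {G : SimpleGraph V} {m : V → V} (hm : IsMate G m) : G.Subgraph where
  verts := Set.univ
  Adj u v := v = m u
  adj_sub := by rintro u v rfl; exact hm.adj u
  edge_vert _ := trivial
  symm := ⟨by rintro u v rfl; exact (hm.invol u).symm⟩

theorem IsMate.ne {G : SimpleGraph V} {m : V → V} (hm : IsMate G m) (v : V) : m v ≠ v :=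
  (hm.adj v).ne'

theorem IsMate.coFactor_adj {G : SimpleGraph V} {m : V → V} (hm : IsMate G m) {u v : V} :
    (coFactor G m).Adj u v ↔ G.Adj u v ∧ v ≠ m u := by
  refine ⟨fun h => ⟨h.1, h.2.1⟩, fun h => ⟨h.1, h.2, ?_⟩⟩
  rintro rfl
  exact h.2 (hm.invol v).symm

theorem IsMate.isPerfectMatching {G : SimpleGraph V} {m : V → V} (hm : IsMate G m) :
    hm.toSubgraph.IsPerfectMatching :=
  ⟨fun v _ => ⟨m v, rfl, fun _ h => h⟩, fun _ => trivial⟩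

theorem IsMate.compl2Factor_eq {G : SimpleGraph V} {m : V → V} (hm : IsMate G m) :
    compl2Factor G hm.toSubgraph = coFactor G m := by
  ext u v
  rw [hm.coFactor_adj, compl2Factor, SimpleGraph.deleteEdges_adj]
  rfl

theorem IsMate.sum_eq_zero [Fintype V] {G : SimpleGraph V} {m : V → V} (hm : IsMate G m)
    {f : V → ZMod 2} (hf : ∀ v, f (m v) = f v) : ∑ v, f v = 0 :=
  Finset.sum_ninvolution m (fun v => by rw [hf]; exact CharTwo.add_self_eq_zero _)
    (fun v _ => hm.ne v) (fun _ => Finset.mem_univ _) hm.invol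

/-- If the partners under a perfect matching `m` are connected in `F`, except perhaps for the
pair `x`, `m x`, then the components of `F` have even order, up to a correction at `x`, `m x`. -/
theorem IsMate.sum_reachable [Fintype V] {G F : SimpleGraph V} {m : V → V} (hm : IsMate G m)
    {x : V} (hF : ∀ v, v ≠ x → v ≠ m x → F.Reachable v (m v)) (u : V) :
    ∑ v with F.Reachable u v, (1 : ZMod 2) =
      (if F.Reachable u x then 1 else 0) + if F.Reachable u (m x) then 1 else 0 := by
  have h0 := hm.sum_eq_zero
    (f := fun v => if F.Reachable u v ∧ v ≠ x ∧ v ≠ m x then (1 : ZMod 2) else 0) (by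
      intro v
      have h1 : m v = x ↔ v = m x :=
        ⟨fun h => by rw [← h, hm.invol], fun h => by rw [h, hm.invol]⟩
      have h2 : m v = m x ↔ v = x :=
        ⟨fun h => by rw [← hm.invol v, h, hm.invol], fun h => by rw [h]⟩
      have h3 : v ≠ x → v ≠ m x → (F.Reachable u (m v) ↔ F.Reachable u v) := fun ha hb =>
        ⟨fun h => h.trans (hF v ha hb).symm, fun h => h.trans (hF v ha hb)⟩
      simp only [h1, h2, ne_eq]
      congr 1
      by_cases ha : v = x <;> by_cases hb : v = m x <;> simp [ha, hb]
      simpa using h3 ha hb)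
  have h1 : ∀ v, (if F.Reachable u v then (1 : ZMod 2) else 0) =
      (if F.Reachable u v ∧ v ≠ x ∧ v ≠ m x then (1 : ZMod 2) else 0) +
      ((if v = x then (if F.Reachable u x then 1 else 0) else 0) +
        if v = m x then (if F.Reachable u (m x) then 1 else 0) else 0) := by
    intro v
    by_cases ha : v = x
    · subst ha
      simp [(hm.ne v).symm]
    · by_cases hb : v = m x
      · subst hb
        simp [hm.ne x]
      · simp [ha, hb]
  rw [Finset.sum_filter, Finset.sum_congr rfl fun v _ => h1 v, Finset.sum_add_distrib, h0,
    Finset.sum_add_distrib]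
  simp

/-- If all components of the complementary 2-factor are even, a constant flow works. -/
theorem IsMate.exists_flow_of_even [Fintype V] {G : SimpleGraph V} {m : V → V} (hm : IsMate G m)
    (hpar : ∀ u, ∑ v with (coFactor G m).Reachable u v, (1 : ZMod 2) = 0) :
    ∃ M : G.Subgraph, M.IsPerfectMatching ∧
      ∃ θ : V → K4, IsNZFlowWrt G M θ ∧ NonConflicting G M θ := by
  refine ⟨hm.toSubgraph, hm.isPerfectMatching, fun _ => flowAlpha,
    ⟨fun _ _ _ => rfl, fun _ => show flowAlpha ≠ 0 by decide, fun u => ?_⟩, ?_⟩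
  · rw [hm.compl2Factor_eq]
    refine Prod.ext ?_ ?_
    · rw [Prod.fst_sum]
      exact hpar u
    · rw [Prod.snd_sum]
      simp [flowAlpha]
  · rintro ⟨_, _, _, _, _, h⟩
    exact absurd (show flowAlpha = flowBeta from h) (by decide)

/-- The vertices that may carry the value `β` when the matching edge of `x` carries `α`. -/
def Free (F : SimpleGraph V) (m : V → V) (x v : V) : Prop :=
  v ≠ x ∧ v ≠ m x ∧ ¬ F.Adj x v ∧ ¬ F.Adj (m x) v

/-- One step of a path for the value `β`: move inside a component of the 2-factor `F`, or along
a matching edge with free ends. -/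
def Step (F : SimpleGraph V) (m : V → V) (x u v : V) : Prop :=
  F.Reachable u v ∨ (v = m u ∧ Free F m x u ∧ Free F m x v)

theorem IsMate.exists_pathFlow [Fintype V] {G F : SimpleGraph V} {m : V → V} (hm : IsMate G m)
    {x y : V} (h : Relation.ReflTransGen (Step F m x) x y) :
    ∃ p : V → ZMod 2, (∀ v, p (m v) = p v) ∧ (∀ v, p v ≠ 0 → Free F m x v) ∧
      ∀ u, ∑ v with F.Reachable u v, p v =
        (if F.Reachable u x then 1 else 0) + if F.Reachable u y then 1 else 0 := by
  induction h with
  | refl =>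
    exact ⟨0, fun _ => rfl, fun _ h => absurd rfl h, fun u => by simp [CharTwo.add_self_eq_zero]⟩
  | @tail y z _ hyz ih =>
    obtain ⟨p, hp1, hp2, hp3⟩ := ih
    rcases hyz with hyz | ⟨rfl, hy, hz⟩
    · refine ⟨p, hp1, hp2, fun u => ?_⟩
      rw [hp3 u]
      have : F.Reachable u y ↔ F.Reachable u z :=
        ⟨fun h => h.trans hyz, fun h => h.trans hyz.symm⟩
      simp [this]
    · refine ⟨fun v => p v + ((if v = y then 1 else 0) + if v = m y then 1 else 0),
        fun v => ?_, fun v hv => ?_, fun u => ?_⟩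
      · have h1 : m v = y ↔ v = m y :=
          ⟨fun h => by rw [← h, hm.invol], fun h => by rw [h, hm.invol]⟩
        have h2 : m v = m y ↔ v = y :=
          ⟨fun h => by rw [← hm.invol v, h, hm.invol], fun h => by rw [h]⟩
        simp only [h1, h2, hp1]
        rw [add_comm (if v = m y then (1 : ZMod 2) else 0)]
      · by_cases h1 : v = y
        · exact h1 ▸ hy
        · by_cases h2 : v = m y
          · exact h2 ▸ hz
          · exact hp2 v (by simpa [h1, h2] using hv)
      · rw [Finset.sum_add_distrib, hp3 u, Finset.sum_add_distrib]
        simp only [Finset.sum_ite_eq', Finset.mem_filter, Finset.mem_univ, true_and]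
        rw [add_assoc, ← add_assoc (if F.Reachable u y then (1 : ZMod 2) else 0),
          CharTwo.add_self_eq_zero, zero_add]

/-- A path for the value `β` from `x` to `m x` gives a non-conflicting flow with value `α` on the
matching edge of `x`, value `β` on the path and value `α + β` elsewhere. -/
theorem IsMate.exists_flow [Fintype V] {G : SimpleGraph V} {m : V → V} (hm : IsMate G m) {x : V}
    (hpar : ∀ u, ∑ v with (coFactor G m).Reachable u v, (1 : ZMod 2) =
      (if (coFactor G m).Reachable u x then 1 else 0) +
        if (coFactor G m).Reachable u (m x) then 1 else 0)
    (h : Relation.ReflTransGen (Step (coFactor G m) m x) x (m x)) :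
    ∃ M : G.Subgraph, M.IsPerfectMatching ∧
      ∃ θ : V → K4, IsNZFlowWrt G M θ ∧ NonConflicting G M θ := by
  obtain ⟨p, hp1, hp2, hp3⟩ := hm.exists_pathFlow h
  have hm1 : ∀ v, m v = x ↔ v = m x := fun v =>
    ⟨fun h => by rw [← h, hm.invol], fun h => by rw [h, hm.invol]⟩
  have hm2 : ∀ v, m v = m x ↔ v = x := fun v =>
    ⟨fun h => by rw [← hm.invol v, h, hm.invol], fun h => by rw [h]⟩
  refine ⟨hm.toSubgraph, hm.isPerfectMatching,
    fun v => (1 - p v, 1 - ((if v = x then 1 else 0) + if v = m x then 1 else 0)),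
    ⟨?_, fun v => ?_, fun u => ?_⟩, ?_⟩
  · rintro u v (rfl : v = m u)
    simp only [hm1, hm2, hp1]
    rw [add_comm (if u = m x then (1 : ZMod 2) else 0)]
  · intro h0
    have h1 := congrArg Prod.fst h0
    have h2 := congrArg Prod.snd h0
    simp only [Prod.fst_zero, Prod.snd_zero] at h1 h2
    have h3 : p v ≠ 0 := by
      intro h
      rw [h] at h1
      exact absurd h1 (by decide)
    obtain ⟨ha, hb, -⟩ := hp2 v h3
    simp [ha, hb] at h2
  · rw [hm.compl2Factor_eq]
    refine Prod.ext ?_ ?_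
    · rw [Prod.fst_sum]
      simp only [Finset.sum_sub_distrib, hp3, hpar, sub_self, Prod.fst_zero]
    · rw [Prod.snd_sum]
      simp only [Finset.sum_sub_distrib, Finset.sum_add_distrib, hpar, Finset.sum_ite_eq',
        Finset.mem_filter, Finset.mem_univ, true_and, sub_self, Prod.snd_zero]
  · rintro ⟨u, v, huv, hM, hu, hv⟩
    have hu' := congrArg Prod.snd hu
    have hv' := congrArg Prod.fst hv
    simp only [flowAlpha, flowBeta] at hu' hv'
    have h3 : p v ≠ 0 := by
      intro h
      rw [h] at hv'
      exact absurd hv' (by decide)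
    obtain ⟨-, -, hc, hd⟩ := hp2 v h3
    have hF : (coFactor G m).Adj u v := hm.coFactor_adj.2 ⟨huv, hM⟩
    by_cases ha : u = x
    · exact hc (ha ▸ hF)
    · by_cases hb : u = m x
      · exact hd (hb ▸ hF)
      · simp [ha, hb] at hu'

/-- The sequence `c 0, …, c (n - 1)` runs once around a component, a cycle, of `H`. -/
structure IsCyc (H : SimpleGraph V) (c : ℕ → V) (n : ℕ) : Prop where
  three_le : 3 ≤ n
  last : c n = c 0
  inj : ∀ i j, i < n → j < n → c i = c j → i = j
  adj : ∀ i, i < n → H.Adj (c i) (c (i + 1))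
  nbr_zero : ∀ w, H.Adj (c 0) w → w = c 1 ∨ w = c (n - 1)
  nbr : ∀ i w, 0 < i → i < n → H.Adj (c i) w → w = c (i + 1) ∨ w = c (i - 1)
  cover : ∀ w, H.Reachable (c 0) w → ∃ i, i < n ∧ w = c i

theorem eq_or_eq_of_ncard {H : SimpleGraph V} {v a b w : V} (h : (H.neighborSet v).ncard = 2)
    (ha : H.Adj v a) (hb : H.Adj v b) (hab : a ≠ b) (hw : H.Adj v w) : w = a ∨ w = b := by
  obtain ⟨p, q, -, hpq⟩ := Set.ncard_eq_two.1 h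
  have key : ∀ z, H.Adj v z → z = p ∨ z = q := fun z hz => by
    have : z ∈ H.neighborSet v := hz
    rwa [hpq] at this
  have := key a ha
  have := key b hb
  have := key w hw
  grind

theorem exists_isCyc [Finite V] {H : SimpleGraph V} (h2 : ∀ v, (H.neighborSet v).ncard = 2)
    (y : V) : ∃ c n, IsCyc H c n ∧ c 0 = y := by
  have hcyc : H.IsCycles := fun v _ => h2 v
  have hne : (H.neighborSet y).Nonempty := by
    rw [← Set.ncard_pos, h2]
    exact two_pos
  obtain ⟨p, hp, hsupp⟩ := hcyc.exists_cycle_toSubgraph_verts_eq_connectedComponentSupp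
    (c := H.connectedComponentMk y) rfl hne
  have h3 := hp.three_le_length
  have h0 : p.getVert 0 = y := p.getVert_zero
  have hl : p.getVert p.length = y := p.getVert_length
  have hadj : ∀ i, i < p.length → H.Adj (p.getVert i) (p.getVert (i + 1)) := fun i hi =>
    p.adj_getVert_succ hi
  have hinj : ∀ i j, i < p.length → j < p.length → p.getVert i = p.getVert j → i = j :=
    fun i j hi hj h => hp.getVert_injOn' (by rw [Set.mem_ofPred]; lia)
      (by rw [Set.mem_ofPred]; lia) h
  have hadj' : H.Adj y (p.getVert (p.length - 1)) := by
    have := hadj (p.length - 1) (by lia)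
    rw [show p.length - 1 + 1 = p.length by lia, hl] at this
    exact this.symm
  refine ⟨p.getVert, p.length, ⟨h3, by rw [hl, h0], hinj, hadj, fun w hw => ?_,
    fun i w hi hin hw => ?_, fun w hw => ?_⟩, h0⟩
  · have hadj0 := hadj 0 (by lia)
    rw [h0] at hadj0 hw
    refine eq_or_eq_of_ncard (h2 y) hadj0 hadj' (fun h => ?_) hw
    have := hinj _ _ (by lia) (by lia) h
    lia
  · have h1 := hadj (i - 1) (by lia)
    rw [show i - 1 + 1 = i by lia] at h1
    refine eq_or_eq_of_ncard (h2 _) (hadj i hin) h1.symm (fun h => ?_) hw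
    rcases Nat.lt_or_ge (i + 1) p.length with h4 | h4
    · have := hinj _ _ h4 (by lia) h
      lia
    · rw [show i + 1 = p.length by lia, hl] at h
      have := hinj _ _ (by lia) (by lia) (h0.trans h)
      lia
  · have hw' : w ∈ p.toSubgraph.verts := by
      rw [hsupp]
      rw [h0] at hw
      exact SimpleGraph.ConnectedComponent.sound hw.symm
    rw [p.mem_verts_toSubgraph, SimpleGraph.Walk.mem_support_iff_exists_getVert] at hw'
    obtain ⟨i, rfl, hi⟩ := hw'
    rcases hi.lt_or_eq with h | h
    · exact ⟨i, h, rfl⟩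
    · exact ⟨0, by lia, by rw [h, hl, h0]⟩

theorem IsCyc.reachable {H : SimpleGraph V} {c : ℕ → V} {n : ℕ} (hc : IsCyc H c n) :
    ∀ i, i ≤ n → H.Reachable (c 0) (c i)
  | 0, _ => SimpleGraph.Reachable.refl _
  | i + 1, hi => (hc.reachable i (by lia)).trans (hc.adj i (by lia)).reachable

theorem IsCyc.card [Fintype V] {H : SimpleGraph V} {c : ℕ → V} {n : ℕ} (hc : IsCyc H c n) :
    (Finset.univ.filter fun v => H.Reachable (c 0) v).card = n := by
  have : Finset.univ.filter (fun v => H.Reachable (c 0) v) = (Finset.range n).image c := by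
    ext v
    simp only [Finset.mem_filter, Finset.mem_univ, true_and, Finset.mem_image, Finset.mem_range]
    constructor
    · intro h
      obtain ⟨i, hi, rfl⟩ := hc.cover v h
      exact ⟨i, hi, rfl⟩
    · rintro ⟨i, hi, rfl⟩
      exact hc.reachable i hi.le
  rw [this, Finset.card_image_of_injOn, Finset.card_range]
  intro i hi j hj h
  exact hc.inj i j (by simpa using hi) (by simpa using hj) h

theorem IsCyc.sum_one [Fintype V] {H : SimpleGraph V} {c : ℕ → V} {n : ℕ} (hc : IsCyc H c n) :
    ∑ v with H.Reachable (c 0) v, (1 : ZMod 2) = n := by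
  rw [Finset.sum_const, hc.card, nsmul_one]

/-- Consecutive terms of an injective sequence can be paired up. -/
theorem exists_pairing (c : ℕ → V) (a t : ℕ)
    (hinj : ∀ i j, a ≤ i → a ≤ j → i < a + 2 * t → j < a + 2 * t → c i = c j → i = j) :
    ∃ m : V → V, ∀ j, j < t →
      m (c (a + 2 * j)) = c (a + 2 * j + 1) ∧ m (c (a + 2 * j + 1)) = c (a + 2 * j) := by
  induction t with
  | zero => exact ⟨id, fun j hj => absurd hj (by lia)⟩
  | succ t ih =>
    obtain ⟨m, hm⟩ := ih fun i j h1 h2 h3 h4 => hinj i j h1 h2 (by lia) (by lia)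
    have hne : ∀ i j, a ≤ i → i < a + 2 * (t + 1) → a ≤ j → j < a + 2 * (t + 1) → i ≠ j →
        c i ≠ c j := fun i j h1 h2 h3 h4 h5 h6 => h5 (hinj i j h1 h3 h2 h4 h6)
    refine ⟨Function.update (Function.update m (c (a + 2 * t)) (c (a + 2 * t + 1)))
      (c (a + 2 * t + 1)) (c (a + 2 * t)), fun j hj => ?_⟩
    rcases Nat.lt_succ_iff_lt_or_eq.1 hj with h | rfl
    · rw [Function.update_of_ne (hne _ _ (by lia) (by lia) (by lia) (by lia) (by lia)),
        Function.update_of_ne (hne _ _ (by lia) (by lia) (by lia) (by lia) (by lia)),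
        Function.update_of_ne (hne _ _ (by lia) (by lia) (by lia) (by lia) (by lia)),
        Function.update_of_ne (hne _ _ (by lia) (by lia) (by lia) (by lia) (by lia))]
      exact hm j h
    · rw [Function.update_of_ne (hne _ _ (by lia) (by lia) (by lia) (by lia) (by lia)),
        Function.update_self, Function.update_self]
      exact ⟨rfl, rfl⟩

/-- `m` is a perfect matching of the component of `y` in `H` with `y` deleted, using edges
of `G`. -/
def IsMateOff (G H : SimpleGraph V) (y : V) (m : V → V) : Prop :=
  ∀ v, H.Reachable y v → v ≠ y →
    H.Reachable y (m v) ∧ m v ≠ y ∧ m (m v) = v ∧ G.Adj v (m v)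

theorem IsCyc.exists_isMateOff {H : SimpleGraph V} {c : ℕ → V} {n : ℕ} (hc : IsCyc H c n)
    (hn : Odd n) : ∃ m, IsMateOff H H (c 0) m := by
  obtain ⟨t, rfl⟩ := hn
  obtain ⟨m, hm⟩ := exists_pairing c 1 t fun i j _ _ h1 h2 => hc.inj i j (by lia) (by lia)
  refine ⟨m, fun v hv hv0 => ?_⟩
  obtain ⟨i, hi, rfl⟩ := hc.cover v hv
  have hi0 : i ≠ 0 := fun h => hv0 (by rw [h])
  have hne : ∀ k, 0 < k → k < 2 * t + 1 → c k ≠ c 0 := fun k h1 h2 h3 =>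
    h1.ne' (hc.inj _ _ h2 (by lia) h3)
  rcases Nat.even_or_odd' i with ⟨j, rfl | rfl⟩
  · obtain ⟨h1, h2⟩ := hm (j - 1) (by lia)
    rw [show 1 + 2 * (j - 1) + 1 = 2 * j by lia] at h1 h2
    rw [h2]
    have := hc.adj (1 + 2 * (j - 1)) (by lia)
    rw [show 1 + 2 * (j - 1) + 1 = 2 * j by lia] at this
    exact ⟨hc.reachable _ (by lia), hne _ (by lia) (by lia), h1, this.symm⟩
  · obtain ⟨h1, h2⟩ := hm j (by lia)
    rw [show 1 + 2 * j = 2 * j + 1 by lia] at h1 h2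
    rw [h1]
    exact ⟨hc.reachable _ (by lia), hne _ (by lia) (by lia), h2, hc.adj _ hi⟩

theorem IsCyc.exists_isMateOff_of_chord {G H : SimpleGraph V} {c : ℕ → V} {n : ℕ}
    (hc : IsCyc H c n) (hn : Odd n) (hHG : H ≤ G) (hchord : G.Adj (c 1) (c (n - 1))) :
    ∃ m, IsMateOff G H (c 0) m ∧ m (c 1) = c (n - 1) ∧ m (c (n - 1)) = c 1 ∧
      ∀ i, 1 < i → i < n - 1 → H.Adj (c i) (m (c i)) := by
  obtain ⟨t, rfl⟩ := hn
  rw [Nat.add_sub_cancel] at hchord ⊢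
  have h3 := hc.three_le
  obtain ⟨m', hm'⟩ := exists_pairing c 2 (t - 1)
    fun i j _ _ h1 h2 => hc.inj i j (by lia) (by lia)
  have hne : ∀ i j, i < 2 * t + 1 → j < 2 * t + 1 → i ≠ j → c i ≠ c j := fun i j h1 h2 h3 h4 =>
    h3 (hc.inj _ _ h1 h2 h4)
  obtain ⟨m, hm⟩ : ∃ m, m = Function.update (Function.update m' (c 1) (c (2 * t)))
    (c (2 * t)) (c 1) := ⟨_, rfl⟩
  have hm1 : m (c 1) = c (2 * t) := by
    rw [hm, Function.update_of_ne (hne _ _ (by lia) (by lia) (by lia)), Function.update_self]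
  have hm2 : m (c (2 * t)) = c 1 := by
    rw [hm, Function.update_self]
  have hm3 : ∀ i, 1 < i → i < 2 * t → m (c i) = m' (c i) := fun i h1 h2 => by
    rw [hm, Function.update_of_ne (hne _ _ (by lia) (by lia) (by lia)),
      Function.update_of_ne (hne _ _ (by lia) (by lia) (by lia))]
  have key : ∀ i, 1 < i → i < 2 * t → ∃ k, 1 < k ∧ k < 2 * t ∧ m (c i) = c k ∧
      m (c k) = c i ∧ H.Adj (c i) (c k) := by
    intro i hi1 hi2
    rcases Nat.even_or_odd' i with ⟨j, rfl | rfl⟩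
    · obtain ⟨h1, h2⟩ := hm' (j - 1) (by lia)
      rw [show 2 + 2 * (j - 1) = 2 * j by lia] at h1 h2
      refine ⟨2 * j + 1, by lia, by lia, ?_, ?_, hc.adj _ (by lia)⟩
      · rw [hm3 _ (by lia) (by lia), h1]
      · rw [hm3 _ (by lia) (by lia), h2]
    · obtain ⟨h1, h2⟩ := hm' (j - 1) (by lia)
      rw [show 2 + 2 * (j - 1) = 2 * j by lia] at h1 h2
      refine ⟨2 * j, by lia, by lia, ?_, ?_, (hc.adj _ (by lia)).symm⟩
      · rw [hm3 _ (by lia) (by lia), h2]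
      · rw [hm3 _ (by lia) (by lia), h1]
  refine ⟨m, fun v hv hv0 => ?_, hm1, hm2, fun i h1 h2 => ?_⟩
  · obtain ⟨i, hi, rfl⟩ := hc.cover v hv
    have hi0 : i ≠ 0 := fun h => hv0 (by rw [h])
    by_cases hi1 : i = 1
    · subst hi1
      rw [hm1]
      exact ⟨hc.reachable _ (by lia), hne _ _ (by lia) (by lia) (by lia), hm2, hchord⟩
    · by_cases hi2 : i = 2 * t
      · subst hi2
        rw [hm2]
        exact ⟨hc.reachable _ (by lia), hne _ _ (by lia) (by lia) (by lia), hm1, hchord.symm⟩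
      · obtain ⟨k, hk1, hk2, h1, h2, h3⟩ := key i (by lia) (by lia)
        rw [h1]
        exact ⟨hc.reachable _ (by lia), hne _ _ (by lia) (by lia) (by lia), h2, hHG h3⟩
  · obtain ⟨k, -, -, h3, -, h4⟩ := key i h1 h2
    rwa [h3]

/-- `H` is a 2-factor of the cubic graph `G` and `m` is the complementary perfect matching. -/
structure IsSplit (G H : SimpleGraph V) (m : V → V) : Prop extends IsMate G m where
  le : H ≤ G
  cases : ∀ {u v}, G.Adj u v → H.Adj u v ∨ v = m u
  not_adj : ∀ u, ¬ H.Adj u (m u)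
  two : ∀ v, (H.neighborSet v).ncard = 2

theorem IsSplit.coFactor_eq {G H : SimpleGraph V} {m : V → V} (hs : IsSplit G H m) :
    coFactor G m = H := by
  ext u v
  rw [hs.toIsMate.coFactor_adj]
  constructor
  · rintro ⟨h1, h2⟩
    exact (hs.cases h1).resolve_right h2
  · intro h
    refine ⟨hs.le h, ?_⟩
    rintro rfl
    exact hs.not_adj u h

/-- If `H` has two components, those of `x` and of its partner `c 0`, then perfect matchings of
the components with `x` and `c 0` deleted, together with the matching edge of `x`, form a perfect
matching with a non-conflicting flow as soon as the components of `x` and of `c 0` in the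
complementary 2-factor meet the path `c 2, …, c (n - 2)`. -/
theorem IsSplit.exists_flow_of_isMateOff [Fintype V] {G H : SimpleGraph V} {m m₁ m₂ : V → V}
    (hs : IsSplit G H m) {c : ℕ → V} {n : ℕ} (hc : IsCyc H c n) {x : V} (hx : m x = c 0)
    (hxc : ¬ H.Reachable x (c 0)) (hcov : ∀ v, H.Reachable x v ∨ H.Reachable (c 0) v)
    (h₁ : IsMateOff H H x m₁) (h₂ : IsMateOff G H (c 0) m₂)
    (hpar : ∀ v, H.Reachable (c 0) v → v ≠ c 0 → m₂ v = m v → H.Adj (c 0) v)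
    {x₂ : V} (hx₂ : H.Adj x x₂) {j : ℕ} (hj : 1 < j) (hjn : j < n - 1) (hxj : m x₂ = c j)
    {a : V} (ha : H.Adj (c 0) a) {i : ℕ} (hi : 1 < i) (hin : i < n - 1) (hai : G.Adj a (c i))
    (hmai : m₂ a ≠ c i) :
    ∃ M : G.Subgraph, M.IsPerfectMatching ∧
      ∃ θ : V → K4, IsNZFlowWrt G M θ ∧ NonConflicting G M θ := by
  have hdisj : ∀ v, H.Reachable (c 0) v → ¬ H.Reachable x v := fun v h h' => hxc (h'.trans h.symm)
  have hcx : c 0 ≠ x := fun h => hxc (by rw [h])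
  obtain ⟨m', hm'⟩ : ∃ m' : V → V, ∀ v, m' v = if v = x then c 0 else if v = c 0 then x else
      if H.Reachable x v then m₁ v else m₂ v := ⟨_, fun _ => rfl⟩
  have hm'x : m' x = c 0 := by rw [hm', if_pos rfl]
  have hm'c : m' (c 0) = x := by rw [hm', if_neg hcx, if_pos rfl]
  have hm'1 : ∀ v, H.Reachable x v → v ≠ x → m' v = m₁ v := fun v hv hvx => by
    rw [hm', if_neg hvx, if_neg (fun h : v = c 0 => hxc (h ▸ hv)), if_pos hv]
  have hm'2 : ∀ v, H.Reachable (c 0) v → v ≠ c 0 → m' v = m₂ v := fun v hv hvc => by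
    rw [hm', if_neg (fun h : v = x => hdisj v hv (h ▸ SimpleGraph.Reachable.refl _)), if_neg hvc,
      if_neg (hdisj v hv)]
  have hmate : IsMate G m' := by
    have key : ∀ v, m' (m' v) = v ∧ G.Adj v (m' v) := by
      intro v
      by_cases hvx : v = x
      · subst hvx
        rw [hm'x, hm'c, ← hx]
        exact ⟨rfl, hs.adj _⟩
      · by_cases hvc : v = c 0
        · subst hvc
          rw [hm'c, hm'x, ← hx]
          exact ⟨rfl, (hs.adj _).symm⟩
        · rcases hcov v with hv | hv
          · obtain ⟨e1, e2, e3, e4⟩ := h₁ v hv hvx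
            rw [hm'1 v hv hvx, hm'1 _ e1 e2]
            exact ⟨e3, hs.le e4⟩
          · obtain ⟨e1, e2, e3, e4⟩ := h₂ v hv hvc
            rw [hm'2 v hv hvc, hm'2 _ e1 e2]
            exact ⟨e3, e4⟩
    exact ⟨fun v => (key v).1, fun v => (key v).2⟩
  have hF0 : ∀ v, H.Adj (c 0) v → (coFactor G m').Adj (c 0) v := fun v hv =>
    hmate.coFactor_adj.2 ⟨hs.le hv, by rw [hm'c]; rintro rfl; exact hxc hv.reachable.symm⟩
  have hF1 : ∀ v, H.Adj x v → (coFactor G m').Adj x v := fun v hv =>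
    hmate.coFactor_adj.2 ⟨hs.le hv, by rw [hm'x]; rintro rfl; exact hxc hv.reachable⟩
  have hparity := hs.toIsMate.sum_reachable (F := coFactor G m') (x := x) (by
    intro v hvx hvc
    rw [hx] at hvc
    by_cases h : m' v = m v
    · rcases hcov v with hv | hv
      · rw [hm'1 v hv hvx] at h
        exact absurd (h ▸ (h₁ v hv hvx).2.2.2) (hs.not_adj v)
      · have hv' := h
        rw [hm'2 v hv hvc] at h
        obtain ⟨e1, e2, e3, -⟩ := h₂ v hv hvc
        have := hpar _ e1 e2 (by rw [e3, h, hs.invol])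
        rw [h] at this
        exact (hF0 _ (hpar v hv hvc h)).reachable.symm.trans (hF0 _ this).reachable
    · exact (hmate.coFactor_adj.2 ⟨hs.adj v, fun h' => h h'.symm⟩).reachable)
  have hci : ∀ k, 1 < k → k < n - 1 → c k ≠ c 0 := fun k h1 h2 h3 => by
    have := hc.inj _ _ (by lia) (by lia) h3
    lia
  have hfree : ∀ k, 1 < k → k < n - 1 → Free (coFactor G m') m' x (c k) := by
    intro k h1 h2
    have hr := hc.reachable k (by lia)
    refine ⟨fun h => hdisj _ hr (h ▸ SimpleGraph.Reachable.refl _), ?_, fun h => ?_, fun h => ?_⟩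
    · rw [hm'x]
      exact hci k h1 h2
    · rcases hs.cases h.1 with h | h
      · exact hdisj _ hr h.reachable
      · exact hci k h1 h2 (h.trans hx)
    · rw [hm'x] at h
      rcases hs.cases h.1 with h | h
      · rcases hc.nbr_zero _ h with h | h
        · have := hc.inj _ _ (by lia) (by have := hc.three_le; lia) h
          lia
        · have := hc.inj _ _ (by lia) (by lia) h
          lia
      · rw [← hx, hs.invol] at h
        exact hdisj _ hr (h ▸ SimpleGraph.Reachable.refl _)
  have hchain : ∀ k, 1 < k → k < n - 1 →
      Relation.ReflTransGen (Step (coFactor G m') m' x) (c 2) (c k) := by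
    intro k h1
    induction k, h1 using Nat.le_induction with
    | base => exact fun _ => Relation.ReflTransGen.refl
    | succ k h1 ih =>
      intro h2
      refine (ih (by lia)).tail ?_
      by_cases h : c (k + 1) = m' (c k)
      · exact Or.inr ⟨h, hfree k h1 (by lia), hfree _ (by lia) h2⟩
      · exact Or.inl (hmate.coFactor_adj.2 ⟨hs.le (hc.adj k (by lia)), h⟩).reachable
  have : Std.Symm (Step (coFactor G m') m' x) := by
    constructor
    rintro u v (h | ⟨h, hu, hv⟩)
    · exact Or.inl h.symm
    · exact Or.inr ⟨by rw [h, hmate.invol], hv, hu⟩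
  have hxx₂ : x₂ ≠ x := hx₂.ne'
  have hstart : (coFactor G m').Reachable x (c j) := by
    refine (hF1 _ hx₂).reachable.trans ?_
    rw [← hxj]
    refine (hmate.coFactor_adj.2 ⟨hs.adj _, ?_⟩).reachable
    rw [hm'1 _ hx₂.reachable hxx₂]
    intro h
    exact hs.not_adj x₂ (h ▸ (h₁ _ hx₂.reachable hxx₂).2.2.2)
  have hend : (coFactor G m').Reachable (c i) (c 0) := by
    refine ((hF0 _ ha).reachable.trans
      (hmate.coFactor_adj.2 ⟨hai, ?_⟩).reachable).symm
    rw [hm'2 _ ha.reachable ha.ne']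
    exact hmai.symm
  refine hmate.exists_flow (x := x) (by simpa only [hm'x, hx] using hparity) ?_
  rw [hm'x]
  refine Relation.ReflTransGen.head (Or.inl hstart) (Relation.ReflTransGen.trans ?_
    (Relation.ReflTransGen.tail (hchain i hi hin) (Or.inl hend)))
  exact symm (hchain j hj hjn)

/-- Two odd cycles, with two matching edges between them whose ends are adjacent in the first
cycle and not in the second, and such that not both neighbours of `m x` are matched into the first
cycle. -/
theorem IsSplit.exists_flow_of_adj [Fintype V] {G H : SimpleGraph V} {m : V → V}
    (hs : IsSplit G H m) {x x₂ : V} (hxy : ¬ H.Reachable x (m x))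
    (hcov : ∀ v, H.Reachable x v ∨ H.Reachable (m x) v)
    (hodd : ∀ u, ∑ v with H.Reachable u v, (1 : ZMod 2) = 1)
    (hx₂ : H.Adj x x₂) (hy₂ : H.Reachable (m x) (m x₂)) (hyy₂ : ¬ H.Adj (m x) (m x₂))
    (hcross : ∀ a b, H.Adj (m x) a → H.Adj (m x) b → a ≠ b →
      H.Reachable (m x) (m a) ∨ H.Reachable (m x) (m b)) :
    ∃ M : G.Subgraph, M.IsPerfectMatching ∧
      ∃ θ : V → K4, IsNZFlowWrt G M θ ∧ NonConflicting G M θ := by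
  obtain ⟨d, k, hd, hdx⟩ := exists_isCyc hs.two x
  obtain ⟨c, n, hc, hcy⟩ := exists_isCyc hs.two (m x)
  have hk : Odd k := by
    rw [← ZMod.natCast_eq_one_iff_odd, ← hd.sum_one, hodd]
  have hn : Odd n := by
    rw [← ZMod.natCast_eq_one_iff_odd, ← hc.sum_one, hodd]
  obtain ⟨m₁, hm₁⟩ := hd.exists_isMateOff hk
  rw [hdx] at hm₁
  rw [← hcy] at hxy hcov hy₂ hyy₂ hcross
  have h3 := hc.three_le
  have hlast : H.Adj (c 0) (c (n - 1)) := by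
    have := hc.adj (n - 1) (by lia)
    rw [show n - 1 + 1 = n by lia, hc.last] at this
    exact this.symm
  have hfirst := hc.adj 0 (by lia)
  rw [zero_add] at hfirst
  have hmid : ∀ v, H.Reachable (c 0) v → v ≠ c 0 → v ≠ c 1 → v ≠ c (n - 1) →
      ∃ j, 1 < j ∧ j < n - 1 ∧ v = c j := by
    intro v hv hv0 hv1 hvn
    obtain ⟨j, hj, rfl⟩ := hc.cover v hv
    refine ⟨j, ?_, ?_, rfl⟩
    · by_contra h
      rcases (by lia : j = 0 ∨ j = 1) with rfl | rfl
      · exact hv0 rfl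
      · exact hv1 rfl
    · by_contra h
      exact hvn (by rw [show j = n - 1 by lia])
  obtain ⟨j, hj, hjn, hxj⟩ := hmid _ hy₂ (by
      rw [hcy]
      intro h
      have := congrArg m h
      rw [hs.invol, hs.invol] at this
      exact hx₂.ne' this)
    (fun h => hyy₂ (h ▸ hfirst)) (fun h => hyy₂ (h ▸ hlast))
  have h1n : c 1 ≠ c (n - 1) := fun h => by
    have := hc.inj _ _ (by lia) (by lia) h
    lia
  by_cases hchord : m (c 1) = c (n - 1)
  · obtain ⟨m₂, hm₂, e1, e2, e3⟩ := hc.exists_isMateOff_of_chord hn hs.le (hchord ▸ hs.adj _)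
    refine hs.exists_flow_of_isMateOff hc hcy.symm hxy hcov hm₁ hm₂ ?_ hx₂ hj hjn hxj hfirst
      (i := 2) (by lia) (by lia) (hs.le (hc.adj 1 (by lia))) ?_
    · intro v hv hv0 hmv
      by_cases hv1 : v = c 1
      · exact hv1 ▸ hfirst
      · by_cases hvn : v = c (n - 1)
        · exact hvn ▸ hlast
        · obtain ⟨i, hi, hin, rfl⟩ := hmid v hv hv0 hv1 hvn
          exact absurd (hmv ▸ e3 i hi hin) (hs.not_adj _)
    · rw [e1]
      intro h
      have := hc.inj _ _ (by lia) (by lia) h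
      lia
  · obtain ⟨m₂, hm₂⟩ := hc.exists_isMateOff hn
    have hm₂' : IsMateOff G H (c 0) m₂ := fun v hv hv0 =>
      ⟨(hm₂ v hv hv0).1, (hm₂ v hv hv0).2.1, (hm₂ v hv hv0).2.2.1, hs.le (hm₂ v hv hv0).2.2.2⟩
    have hne : ∀ v, H.Reachable (c 0) v → v ≠ c 0 → m₂ v ≠ m v := fun v hv hv0 h =>
      hs.not_adj v (h ▸ (hm₂ v hv hv0).2.2.2)
    obtain ⟨a, ha, hra, hma1, hman⟩ : ∃ a, H.Adj (c 0) a ∧ H.Reachable (c 0) (m a) ∧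
        m a ≠ c 1 ∧ m a ≠ c (n - 1) := by
      have hchord' : m (c (n - 1)) ≠ c 1 := fun h => hchord (by rw [← h, hs.invol])
      rcases hcross _ _ hfirst hlast h1n with h | h
      · exact ⟨c 1, hfirst, h, hs.ne _, hchord⟩
      · exact ⟨c (n - 1), hlast, h, hchord', hs.ne _⟩
    obtain ⟨i, hi, hin, hai⟩ := hmid _ hra (fun h => by
      have := congrArg m h
      rw [hs.invol, hcy, hs.invol] at this
      exact hxy (this ▸ ha.reachable.symm)) hma1 hman
    exact hs.exists_flow_of_isMateOff hc hcy.symm hxy hcov hm₁ hm₂'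
      (fun v hv hv0 h => absurd h (hne v hv hv0)) hx₂ hj hjn hxj ha hi hin (hai ▸ hs.adj a)
      (hai ▸ hne a ha.reachable ha.ne')

/-- The vertices of the component of `u` in `H` whose partner is in another component. -/
noncomputable def crossing [Fintype V] (H : SimpleGraph V) (m : V → V) (u : V) : Finset V :=
  Finset.univ.filter fun v => H.Reachable u v ∧ ¬ H.Reachable v (m v)

theorem mem_crossing [Fintype V] {H : SimpleGraph V} {m : V → V} {u v : V} :
    v ∈ crossing H m u ↔ H.Reachable u v ∧ ¬ H.Reachable v (m v) := by
  simp [crossing]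

theorem IsMate.odd_card_crossing [Fintype V] {G H : SimpleGraph V} {m : V → V} (hm : IsMate G m)
    {u : V} (hodd : ∑ v with H.Reachable u v, (1 : ZMod 2) = 1) : Odd (crossing H m u).card := by
  have h0 := hm.sum_eq_zero
    (f := fun v => if H.Reachable u v ∧ H.Reachable u (m v) then (1 : ZMod 2) else 0)
    (fun v => by simp only [hm.invol, and_comm])
  have h1 : ∀ v, (if H.Reachable u v then (1 : ZMod 2) else 0) =
      (if H.Reachable u v ∧ H.Reachable u (m v) then 1 else 0) +
        if H.Reachable u v ∧ ¬ H.Reachable v (m v) then 1 else 0 := by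
    intro v
    by_cases ha : H.Reachable u v
    · have : H.Reachable u (m v) ↔ H.Reachable v (m v) :=
        ⟨fun h => ha.symm.trans h, fun h => ha.trans h⟩
      by_cases hb : H.Reachable v (m v) <;> simp [ha, hb, this]
    · simp [ha]
  rw [Finset.sum_filter, Finset.sum_congr rfl fun v _ => h1 v, Finset.sum_add_distrib, h0,
    zero_add, Finset.sum_boole] at hodd
  rwa [ZMod.natCast_eq_one_iff_odd] at hodd

theorem IsSplit.card_crossing_ne_one [Fintype V] {G H : SimpleGraph V} {m : V → V}
    (hs : IsSplit G H m)
    (hbridge : ∀ u v, G.Adj u v → (G.deleteEdges {s(u, v)}).Reachable u v) (u : V) :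
    (crossing H m u).card ≠ 1 := by
  intro h
  obtain ⟨x, hx⟩ := Finset.card_eq_one.1 h
  have hxm : x ∈ crossing H m u := by simp [hx]
  have hxu := mem_crossing.1 hxm
  have hr := hbridge x (m x) (hs.adj x)
  rw [SimpleGraph.reachable_iff_reflTransGen] at hr
  have key : ∀ v, Relation.ReflTransGen (G.deleteEdges {s(x, m x)}).Adj x v →
      H.Reachable x v := by
    intro v hv
    induction hv with
    | refl => exact SimpleGraph.Reachable.refl _
    | @tail v w _ hvw ih =>
      rw [SimpleGraph.deleteEdges_adj] at hvw
      rcases hs.cases hvw.1 with h1 | h1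
      · exact ih.trans h1.reachable
      · by_contra hw
        have hv : v ∈ crossing H m u :=
          mem_crossing.2 ⟨hxu.1.trans ih, fun h2 => hw (ih.trans (h1 ▸ h2))⟩
        rw [hx, Finset.mem_singleton] at hv
        subst hv
        exact hvw.2 (by rw [h1]; rfl)
  exact hxu.2 (key _ hr)

/-- Two matching edges between two odd cycles whose ends are not adjacent in either cycle. -/
theorem IsSplit.exists_flow_of_not_adj [Fintype V] {G H : SimpleGraph V} {m : V → V}
    (hs : IsSplit G H m) (hcov : ∀ u v w, H.Reachable u v ∨ H.Reachable u w ∨ H.Reachable v w)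
    (hodd : ∀ u, ∑ v with H.Reachable u v, (1 : ZMod 2) = 1) {u x y : V}
    (hx : x ∈ crossing H m u) (hy : y ∈ crossing H m u) (hxy : x ≠ y) (h₁ : ¬ H.Adj x y)
    (h₂ : ¬ H.Adj (m x) (m y)) :
    ∃ M : G.Subgraph, M.IsPerfectMatching ∧
      ∃ θ : V → K4, IsNZFlowWrt G M θ ∧ NonConflicting G M θ := by
  obtain ⟨hux, hx⟩ := mem_crossing.1 hx
  obtain ⟨huy, hy⟩ := mem_crossing.1 hy
  have hrxy : H.Reachable x y := hux.symm.trans huy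
  have hxmy : ¬ H.Reachable x (m y) := fun h => hy (hrxy.symm.trans h)
  have hmxy : ¬ H.Reachable (m x) y := fun h => hx (hrxy.trans h.symm)
  have hmm : H.Reachable (m x) (m y) :=
    ((hcov x (m x) (m y)).resolve_left hx).resolve_left hxmy
  refine hs.toIsMate.exists_flow (x := x) (fun v => ?_) ?_
  · rw [hs.coFactor_eq, hodd v]
    by_cases h1 : H.Reachable v x
    · rw [if_pos h1, if_neg fun h => hx (h1.symm.trans h), add_zero]
    · rw [if_neg h1, zero_add, if_pos]
      exact ((hcov v x (m x)).resolve_left h1).resolve_right hx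
  · rw [hs.coFactor_eq]
    refine Relation.ReflTransGen.head (Or.inl hrxy) (Relation.ReflTransGen.head (b := m y)
      (c := m x) (Or.inr ⟨rfl, ⟨hxy.symm, ?_, h₁, ?_⟩, ?_, ?_, ?_, h₂⟩)
      (Relation.ReflTransGen.single (Or.inl hmm.symm)))
    · exact fun h => hx (h ▸ hrxy)
    · exact fun h => hmxy h.reachable
    · exact fun h => hxmy (h ▸ SimpleGraph.Reachable.refl _)
    · intro h
      have := congrArg m h
      rw [hs.invol, hs.invol] at this
      exact hxy this.symm
    · exact fun h => hxmy h.reachable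

theorem mem_of_reachable {H : SimpleGraph V} {P : V → Prop} (hP : ∀ v w, P v → H.Adj v w → P w)
    {u v : V} (hu : P u) (h : H.Reachable u v) : P v := by
  rw [SimpleGraph.reachable_iff_reflTransGen] at h
  induction h with
  | refl => exact hu
  | tail _ h ih => exact hP _ _ ih h

theorem not_mem_of_four {s : Finset V} {a b c d : V} (hs : s.card ≤ 3) (ha : a ∈ s) (hb : b ∈ s)
    (hc : c ∈ s) (hd : d ∈ s) (hab : a ≠ b) (hac : a ≠ c) (had : a ≠ d) (hbc : b ≠ c)
    (hbd : b ≠ d) (hcd : c ≠ d) : False := by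
  have h1 : ({a, b, c, d} : Finset V) ⊆ s := by
    intro z
    simp only [Finset.mem_insert, Finset.mem_singleton]
    rintro (rfl | rfl | rfl | rfl) <;> assumption
  have h2 := Finset.card_le_card h1
  rw [Finset.card_insert_of_notMem (by simp [hab, hac, had]),
    Finset.card_insert_of_notMem (by simp [hbc, hbd]), Finset.card_pair hcd] at h2
  lia

/-- Two triangles joined by a perfect matching. -/
theorem IsSplit.exists_flow_of_prism [Fintype V] {G H : SimpleGraph V} {m : V → V}
    (hs : IsSplit G H m) {x y z : V} (hxm : ¬ H.Reachable x (m x))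
    (hcov : ∀ v, H.Reachable x v ∨ H.Reachable (m x) v)
    (hxy : H.Adj x y) (hxz : H.Adj x z) (hyz : H.Adj y z) (hmxy : H.Adj (m x) (m y))
    (hmxz : H.Adj (m x) (m z)) (hmyz : H.Adj (m y) (m z)) :
    ∃ M : G.Subgraph, M.IsPerfectMatching ∧
      ∃ θ : V → K4, IsNZFlowWrt G M θ ∧ NonConflicting G M θ := by
  have tri : ∀ a b c, H.Adj a b → H.Adj a c → H.Adj b c → ∀ v, H.Reachable a v →
      v = a ∨ v = b ∨ v = c := by
    intro a b c hab hac hbc v hv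
    refine mem_of_reachable (P := fun v => v = a ∨ v = b ∨ v = c) ?_ (Or.inl rfl) hv
    rintro v w (rfl | rfl | rfl) hw
    · exact Or.inr (eq_or_eq_of_ncard (hs.two _) hab hac hbc.ne hw)
    · rcases eq_or_eq_of_ncard (hs.two _) hab.symm hbc hac.ne hw with h | h <;> simp [h]
    · rcases eq_or_eq_of_ncard (hs.two _) hac.symm hbc.symm hab.ne hw with h | h <;> simp [h]
  have hne : ∀ a b, H.Reachable x a → H.Reachable (m x) b → a ≠ b := fun a b ha hb h =>
    hxm (ha.trans (h ▸ hb.symm))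
  have n1 := hne x (m x) (by rfl) (by rfl)
  have n2 := hne x (m y) (by rfl) hmxy.reachable
  have n3 := hne x (m z) (by rfl) hmxz.reachable
  have n4 := hne y (m x) hxy.reachable (by rfl)
  have n5 := hne y (m y) hxy.reachable hmxy.reachable
  have n6 := hne y (m z) hxy.reachable hmxz.reachable
  have n7 := hne z (m x) hxz.reachable (by rfl)
  have n8 := hne z (m y) hxz.reachable hmxy.reachable
  have n9 := hne z (m z) hxz.reachable hmxz.reachable
  have a1 := hxy.ne
  have a2 := hxz.ne
  have a3 := hyz.ne
  have a4 := hmxy.ne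
  have a5 := hmxz.ne
  have a6 := hmyz.ne
  have hall : ∀ v, v = x ∨ v = y ∨ v = z ∨ v = m x ∨ v = m y ∨ v = m z := by
    intro v
    rcases hcov v with h | h
    · have := tri x y z hxy hxz hyz v h
      tauto
    · have := tri _ _ _ hmxy hmxz hmyz v h
      tauto
  obtain ⟨m', hm'⟩ : ∃ m' : V → V, ∀ v, m' v = if v = x then y else if v = y then x else
      if v = m x then m y else if v = m y then m x else m v := ⟨_, fun _ => rfl⟩
  have e1 : m' x = y := by rw [hm', if_pos rfl]
  have e2 : m' y = x := by rw [hm', if_neg a1.symm, if_pos rfl]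
  have e3 : m' (m x) = m y := by rw [hm', if_neg n1.symm, if_neg n4.symm, if_pos rfl]
  have e4 : m' (m y) = m x := by
    rw [hm', if_neg n2.symm, if_neg n5.symm, if_neg a4.symm, if_pos rfl]
  have e5 : m' z = m z := by rw [hm', if_neg a2.symm, if_neg a3.symm, if_neg n7, if_neg n8]
  have e6 : m' (m z) = z := by
    rw [hm', if_neg n3.symm, if_neg n6.symm, if_neg a5.symm, if_neg a6.symm, hs.invol]
  have hmate : IsMate G m' := by
    constructor <;> intro v <;> rcases hall v with rfl | rfl | rfl | rfl | rfl | rfl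
    · rw [e1, e2]
    · rw [e2, e1]
    · rw [e5, e6]
    · rw [e3, e4]
    · rw [e4, e3]
    · rw [e6, e5]
    · rw [e1]; exact hs.le hxy
    · rw [e2]; exact hs.le hxy.symm
    · rw [e5]; exact hs.adj _
    · rw [e3]; exact hs.le hmxy
    · rw [e4]; exact hs.le hmxy.symm
    · rw [e6]; exact (hs.adj _).symm
  have r1 : (coFactor G m').Reachable x (m x) :=
    (hmate.coFactor_adj.2 ⟨hs.adj x, by rw [e1]; exact n4.symm⟩).reachable
  have r2 : (coFactor G m').Reachable y (m y) :=
    (hmate.coFactor_adj.2 ⟨hs.adj y, by rw [e2]; exact n2.symm⟩).reachable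
  have r3 : (coFactor G m').Reachable x z :=
    (hmate.coFactor_adj.2 ⟨hs.le hxz, by rw [e1]; exact a3.symm⟩).reachable
  have r4 : (coFactor G m').Reachable (m x) (m z) :=
    (hmate.coFactor_adj.2 ⟨hs.le hmxz, by rw [e3]; exact a6.symm⟩).reachable
  have r5 : (coFactor G m').Reachable z (m z) := (r3.symm.trans r1).trans r4
  refine hmate.exists_flow_of_even fun u => ?_
  rw [hs.toIsMate.sum_reachable (F := coFactor G m') (x := x) ?_ u]
  · have : (coFactor G m').Reachable u x ↔ (coFactor G m').Reachable u (m x) :=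
      ⟨fun h => h.trans r1, fun h => h.trans r1.symm⟩
    simp only [this]
    exact CharTwo.add_self_eq_zero _
  · intro v _ _
    rcases hall v with rfl | rfl | rfl | rfl | rfl | rfl
    · exact r1
    · exact r2
    · exact r5
    · rw [hs.invol]; exact r1.symm
    · rw [hs.invol]; exact r2.symm
    · rw [hs.invol]; exact r5.symm

theorem IsSplit.exists_flow_of_card_crossing_eq_three [Fintype V] {G H : SimpleGraph V}
    {m : V → V} (hs : IsSplit G H m)
    (hcov : ∀ u v w, H.Reachable u v ∨ H.Reachable u w ∨ H.Reachable v w)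
    (hodd : ∀ u, ∑ v with H.Reachable u v, (1 : ZMod 2) = 1) {u : V}
    (hcard : (crossing H m u).card = 3) :
    ∃ M : G.Subgraph, M.IsPerfectMatching ∧
      ∃ θ : V → K4, IsNZFlowWrt G M θ ∧ NonConflicting G M θ := by
  have hminj : ∀ a b, m a = m b → a = b := fun a b h => by rw [← hs.invol a, h, hs.invol]
  have hcov' : ∀ a b, ¬ H.Reachable a b → ∀ v, H.Reachable a v ∨ H.Reachable b v :=
    fun a b h v => (hcov a b v).resolve_left h
  have hmm : ∀ a b, a ∈ crossing H m u → b ∈ crossing H m u → H.Reachable (m a) (m b) := by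
    intro a b ha hb
    rw [mem_crossing] at ha hb
    exact (hcov' _ _ ha.2 (m b)).resolve_left
      fun h => hb.2 ((hb.1.symm.trans ha.1).trans h)
  have hcross : ∀ a b, a ∈ crossing H m u → ¬ H.Reachable a b → ¬ H.Reachable (m a) (m b) →
      m b ∈ crossing H m u := by
    intro a b ha hab hmab
    rw [mem_crossing] at ha ⊢
    refine ⟨ha.1.trans ((hcov' _ _ ha.2 (m b)).resolve_right hmab), fun h => hab ?_⟩
    rw [hs.invol] at h
    exact ((hcov' _ _ ha.2 (m b)).resolve_right hmab).trans h
  by_cases hone : ∃ x ∈ crossing H m u, ∃ y ∈ crossing H m u, H.Adj x y ∧ ¬ H.Adj (m x) (m y)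
  · obtain ⟨x, hx, y, hy, hxy, hmxy⟩ := hone
    have hxm := (mem_crossing.1 hx).2
    refine hs.exists_flow_of_adj hxm (hcov' _ _ hxm) hodd hxy (hmm x y hx hy) hmxy ?_
    intro a b ha hb hab
    by_contra hc
    rw [not_or] at hc
    have hxa : ¬ H.Reachable x a := fun h => hxm (h.trans ha.reachable.symm)
    have hxb : ¬ H.Reachable x b := fun h => hxm (h.trans hb.reachable.symm)
    refine not_mem_of_four hcard.le hx hy (hcross x a hx hxa hc.1) (hcross x b hx hxb hc.2)
      hxy.ne ?_ ?_ ?_ ?_ fun h => hab (hminj _ _ h)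
    · exact fun h => ha.ne (by rw [h, hs.invol])
    · exact fun h => hb.ne (by rw [h, hs.invol])
    · exact fun h => hmxy (by rw [h, hs.invol]; exact ha)
    · exact fun h => hmxy (by rw [h, hs.invol]; exact hb)
  by_cases htwo : ∃ x ∈ crossing H m u, ∃ y ∈ crossing H m u, H.Adj (m x) (m y) ∧ ¬ H.Adj x y
  · obtain ⟨x, hx, y, hy, hmxy, hxy⟩ := htwo
    have hxm := (mem_crossing.1 hx).2
    have hxm' : ¬ H.Reachable (m x) (m (m x)) := by
      rw [hs.invol]
      exact fun h => hxm h.symm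
    refine hs.exists_flow_of_adj hxm' (hcov' _ _ hxm') hodd hmxy ?_ ?_ ?_
    · rw [hs.invol, hs.invol]
      exact (mem_crossing.1 hx).1.symm.trans (mem_crossing.1 hy).1
    · rwa [hs.invol, hs.invol]
    · rw [hs.invol]
      intro a b ha hb hab
      by_contra hc
      rw [not_or] at hc
      have hmem : ∀ a, H.Adj x a → ¬ H.Reachable x (m a) → a ∈ crossing H m u := fun a ha h =>
        mem_crossing.2 ⟨(mem_crossing.1 hx).1.trans ha.reachable,
          fun h' => h (ha.reachable.trans h')⟩
      exact not_mem_of_four hcard.le hx hy (hmem a ha hc.1) (hmem b hb hc.2)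
        (fun h => hmxy.ne (by rw [h])) ha.ne hb.ne (fun h => hxy (h ▸ ha)) (fun h => hxy (h ▸ hb))
        hab
  push Not at hone htwo
  by_cases hall : ∀ x ∈ crossing H m u, ∀ y ∈ crossing H m u, x ≠ y → H.Adj x y
  · obtain ⟨x, y, z, hxy, hxz, hyz, hxyz⟩ := Finset.card_eq_three.1 hcard
    have hx : x ∈ crossing H m u := by simp [hxyz]
    have hy : y ∈ crossing H m u := by simp [hxyz]
    have hz : z ∈ crossing H m u := by simp [hxyz]
    have hxm := (mem_crossing.1 hx).2
    have h1 := hall x hx y hy hxy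
    have h2 := hall x hx z hz hxz
    have h3 := hall y hy z hz hyz
    exact hs.exists_flow_of_prism hxm (hcov' _ _ hxm) h1 h2 h3 (hone x hx y hy h1)
      (hone x hx z hz h2) (hone y hy z hz h3)
  · push Not at hall
    obtain ⟨x, hx, y, hy, hxy, h⟩ := hall
    exact hs.exists_flow_of_not_adj hcov hodd hx hy hxy h fun h' => h (htwo x hx y hy h')

/-- If any two crossing edges have adjacent ends in one of the two cycles, then there are at most
five, and when there are five, the cycles are complementary pentagons. -/
theorem IsSplit.crossing_of_pairwise [Fintype V] {G H : SimpleGraph V} {m : V → V}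
    (hs : IsSplit G H m) {u : V} (hcard : 5 ≤ (crossing H m u).card)
    (hadj : ∀ x ∈ crossing H m u, ∀ y ∈ crossing H m u, x ≠ y →
      H.Adj x y ∨ H.Adj (m x) (m y)) :
    (crossing H m u).card = 5 ∧ ∀ x ∈ crossing H m u,
      (∀ w, H.Adj x w → w ∈ crossing H m u) ∧ (∀ w, H.Adj (m x) w → m w ∈ crossing H m u) ∧
      ∀ w, ¬ (H.Adj x w ∧ H.Adj (m x) (m w)) := by
  have key : ∀ x ∈ crossing H m u, (crossing H m u).card ≤ 5 ∧
      (∀ w, H.Adj x w → w ∈ crossing H m u) ∧ (∀ w, H.Adj (m x) w → m w ∈ crossing H m u) ∧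
      ∀ w, ¬ (H.Adj x w ∧ H.Adj (m x) (m w)) := by
    intro x hx
    obtain ⟨a, b, hab, hA⟩ := Set.ncard_eq_two.1 (hs.two x)
    obtain ⟨c, d, hcd, hB⟩ := Set.ncard_eq_two.1 (hs.two (m x))
    have hA' : ∀ w, H.Adj x w ↔ w = a ∨ w = b := fun w => by
      have : w ∈ H.neighborSet x ↔ w ∈ ({a, b} : Set V) := by rw [hA]
      simpa using this
    have hB' : ∀ w, H.Adj (m x) w ↔ w = c ∨ w = d := fun w => by
      have : w ∈ H.neighborSet (m x) ↔ w ∈ ({c, d} : Set V) := by rw [hB]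
      simpa using this
    have hm : ∀ w z, m w = z ↔ w = m z := fun w z =>
      ⟨fun h => by rw [← h, hs.invol], fun h => by rw [h, hs.invol]⟩
    have hsub : (crossing H m u).erase x ⊆ {a, b, m c, m d} := by
      intro w hw
      rw [Finset.mem_erase] at hw
      have := hadj x hx w hw.2 hw.1.symm
      rw [hA', hB', hm, hm] at this
      simp only [Finset.mem_insert, Finset.mem_singleton]
      tauto
    have h4 : ({a, b, m c, m d} : Finset V).card ≤ 4 := Finset.card_le_four
    have h5 := Finset.card_le_card hsub
    rw [Finset.card_erase_of_mem hx] at h5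
    have heq := Finset.eq_of_subset_of_card_le hsub (by
      rw [Finset.card_erase_of_mem hx]
      lia)
    have hin : ∀ w ∈ ({a, b, m c, m d} : Finset V), w ∈ crossing H m u := fun w hw =>
      Finset.mem_of_mem_erase (heq ▸ hw)
    have hthree : ∀ p q r : V, ({a, b, m c, m d} : Finset V) ⊆ {p, q, r} → False := by
      intro p q r h
      have h6 := Finset.card_le_card h
      have h7 : ({p, q, r} : Finset V).card ≤ 3 := Finset.card_le_three
      rw [← heq, Finset.card_erase_of_mem hx] at h6
      lia
    refine ⟨by lia, fun w hw => hin w ?_, fun w hw => hin (m w) ?_, ?_⟩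
    · rcases (hA' w).1 hw with rfl | rfl <;> simp
    · rcases (hB' w).1 hw with rfl | rfl <;> simp
    · rintro w ⟨h1, h2⟩
      rw [hA'] at h1
      rw [hB', hm, hm] at h2
      rcases h1 with rfl | rfl <;> rcases h2 with h2 | h2 <;> rw [h2] at hthree
      · exact hthree (m c) b (m d) (by intro z; simp only [Finset.mem_insert, Finset.mem_singleton]; tauto)
      · exact hthree (m d) b (m c) (by intro z; simp only [Finset.mem_insert, Finset.mem_singleton]; tauto)
      · exact hthree a (m c) (m d) (by intro z; simp only [Finset.mem_insert, Finset.mem_singleton]; tauto)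
      · exact hthree a (m d) (m c) (by intro z; simp only [Finset.mem_insert, Finset.mem_singleton]; tauto)
  have hne : (crossing H m u).Nonempty := Finset.card_pos.1 (by lia)
  obtain ⟨x, hx⟩ := hne
  exact ⟨le_antisymm (key x hx).1 hcard, fun x hx => (key x hx).2⟩

/-- Adjacency in the Petersen graph drawn as an outer pentagon (`false`), an inner pentagram
(`true`) and spokes. -/
def petersenAdj (p q : Fin 5 × Bool) : Prop :=
  match p.2, q.2 with
  | false, false => q.1 = p.1 + 1 ∨ p.1 = q.1 + 1
  | true, true => p.1 ≠ q.1 ∧ ¬ (q.1 = p.1 + 1 ∨ p.1 = q.1 + 1)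
  | _, _ => p.1 = q.1

/-- The labels of the vertices of the drawing of the Petersen graph in `petersenAdj`. -/
def petersenLabel (p : Fin 5 × Bool) : {s : Finset (Fin 5) // s.card = 2} :=
  match p.2 with
  | false => ⟨{2 * p.1, 2 * p.1 + 1}, Finset.card_pair (by simp)⟩
  | true => ⟨{2 * p.1 + 2, 2 * p.1 + 4}, Finset.card_pair (by simp)⟩

theorem petersenLabel_adj (p q : Fin 5 × Bool) :
    PetersenGraph.Adj (petersenLabel p) (petersenLabel q) ↔ petersenAdj p q := by
  obtain ⟨i, a⟩ := p
  obtain ⟨j, b⟩ := q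
  simp only [PetersenGraph, SimpleGraph.fromRel_adj, petersenAdj, petersenLabel]
  cases a <;> cases b <;> revert i j <;> decide

theorem petersenLabel_bijective : Function.Bijective petersenLabel := by
  rw [Fintype.bijective_iff_injective_and_card]
  refine ⟨?_, ?_⟩
  · rintro ⟨i, a⟩ ⟨j, b⟩ h
    have h' := congrArg Subtype.val h
    simp only [petersenLabel] at h'
    cases a <;> cases b <;> revert i j <;> decide
  · rw [Fintype.card_finset_len]
    rfl

theorem IsCyc.adj_iff {H : SimpleGraph V} {c : ℕ → V} (hc : IsCyc H c 5) (i j : Fin 5) :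
    H.Adj (c i) (c j) ↔ j = i + 1 ∨ i = j + 1 := by
  have hi := i.isLt
  have hj := j.isLt
  have hstep : ∀ i j : Fin 5, j = i + 1 → H.Adj (c i) (c j) := by
    rintro i j rfl
    have h := hc.adj i i.isLt
    by_cases h4 : i = 4
    · subst h4
      have := hc.last
      rw [show (((4 : Fin 5) : ℕ) + 1) = 5 from rfl, this] at h
      exact h
    · rwa [Fin.val_add_one_of_lt' (by lia)]
  constructor
  · intro h
    rw [Fin.ext_iff, Fin.ext_iff, Fin.val_add, Fin.val_add]
    simp only [Fin.val_one]
    rcases Nat.eq_zero_or_pos i.val with h0 | h0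
    · rw [h0] at h
      rcases hc.nbr_zero _ h with h | h
      · have := hc.inj _ _ (by lia) (by lia) h
        lia
      · have := hc.inj _ _ (by lia) (by lia) h
        lia
    · rcases hc.nbr _ _ h0 hi h with h | h
      · rcases Nat.lt_or_ge (i.val + 1) 5 with h5 | h5
        · have := hc.inj _ _ (by lia) (by lia) h
          lia
        · rw [show i.val + 1 = 5 by lia, hc.last] at h
          have := hc.inj _ _ (by lia) (by lia) h
          lia
      · have := hc.inj _ _ (by lia) (by lia) h
        lia
  · rintro (h | h)
    · exact hstep i j h
    · exact (hstep j i h).symm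

theorem IsSplit.nonempty_iso_petersenGraph [Fintype V] {G H : SimpleGraph V} {m : V → V}
    (hs : IsSplit G H m)
    (hcov : ∀ u v w, H.Reachable u v ∨ H.Reachable u w ∨ H.Reachable v w) {u : V}
    (hcard : 5 ≤ (crossing H m u).card)
    (hadj : ∀ x ∈ crossing H m u, ∀ y ∈ crossing H m u, x ≠ y →
      H.Adj x y ∨ H.Adj (m x) (m y)) :
    Nonempty (G ≃g PetersenGraph) := by
  obtain ⟨h5, hX⟩ := hs.crossing_of_pairwise hcard hadj
  obtain ⟨x, hx⟩ : (crossing H m u).Nonempty := Finset.card_pos.1 (by lia)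
  have hreach : ∀ v, H.Reachable x v → v ∈ crossing H m u := fun v hv =>
    mem_of_reachable (P := fun v => v ∈ crossing H m u) (fun v w hv hw => (hX v hv).1 w hw) hx hv
  have hreach' : ∀ v, H.Reachable (m x) v → m v ∈ crossing H m u := fun v hv =>
    mem_of_reachable (P := fun v => m v ∈ crossing H m u)
      (fun v w hv hw => (hX _ hv).2.1 w (by rwa [hs.invol])) (by rwa [hs.invol]) hv
  have hcross : ∀ v, v ∈ crossing H m u ↔ H.Reachable x v := by
    refine fun v => ⟨fun hv => ?_, hreach v⟩
    exact (mem_crossing.1 hx).1.symm.trans (mem_crossing.1 hv).1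
  obtain ⟨d, n, hd, rfl⟩ := exists_isCyc hs.two x
  obtain rfl : n = 5 := by
    rw [← hd.card, ← h5]
    congr 1
    ext v
    simp [hcross]
  have hdX : ∀ i : Fin 5, d i ∈ crossing H m u := fun i =>
    hreach _ (hd.reachable i i.isLt.le)
  have hXd : ∀ v ∈ crossing H m u, ∃ i : Fin 5, d i = v := fun v hv => by
    obtain ⟨i, hi, rfl⟩ := hd.cover v ((hcross v).1 hv)
    exact ⟨⟨i, hi⟩, rfl⟩
  have hdinj : ∀ i j : Fin 5, d i = d j ↔ i = j := fun i j =>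
    ⟨fun h => Fin.ext (hd.inj _ _ i.isLt j.isLt h), fun h => by rw [h]⟩
  have hminj : ∀ a b, m a = m b ↔ a = b :=
    fun a b => ⟨fun h => by rw [← hs.invol a, h, hs.invol], fun h => by rw [h]⟩
  have hnr : ∀ i j : Fin 5, ¬ H.Reachable (d i) (m (d j)) := by
    intro i j h
    have hi := (hcross _).1 (hdX i)
    have hj := (hcross _).1 (hdX j)
    exact (mem_crossing.1 (hdX j)).2 ((hj.symm.trans hi).trans h)
  have hnm : ∀ i j : Fin 5, d i ≠ m (d j) := fun i j h =>
    hnr i j (h ▸ SimpleGraph.Reachable.refl _)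
  have hGH : ∀ a b, G.Adj a b ↔ H.Adj a b ∨ b = m a := by
    refine fun a b => ⟨hs.cases, ?_⟩
    rintro (h | rfl)
    · exact hs.le h
    · exact hs.adj a
  have hmix : ∀ i j : Fin 5, G.Adj (d i) (m (d j)) ↔ i = j := by
    intro i j
    rw [hGH, hminj, hdinj, or_iff_right fun h => hnr i j h.reachable]
    exact eq_comm
  obtain ⟨f, hf⟩ : ∃ f : Fin 5 × Bool → V, ∀ p, f p = if p.2 then m (d p.1) else d p.1 :=
    ⟨_, fun _ => rfl⟩
  have hfbij : Function.Bijective f := by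
    constructor
    · rintro ⟨i, a⟩ ⟨j, b⟩ h
      rw [hf, hf] at h
      cases a <;> cases b
      · simpa [hdinj] using h
      · exact absurd h (hnm i j)
      · exact absurd h.symm (hnm j i)
      · simpa [hminj, hdinj] using h
    · intro v
      have h0 := (mem_crossing.1 hx).2
      rcases (hcov _ _ v).resolve_left h0 with h | h
      · obtain ⟨i, hi⟩ := hXd v (hreach v h)
        exact ⟨(i, false), by simp [hf, hi]⟩
      · obtain ⟨i, hi⟩ := hXd _ (hreach' v h)
        exact ⟨(i, true), by simp [hf, hi, hs.invol]⟩
  have hfadj : ∀ p q, G.Adj (f p) (f q) ↔ petersenAdj p q := by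
    rintro ⟨i, a⟩ ⟨j, b⟩
    rw [hf, hf]
    cases a <;> cases b
    · change G.Adj (d i) (d j) ↔ (j = i + 1 ∨ i = j + 1)
      rw [hGH, or_iff_left (hnm j i), hd.adj_iff]
    · exact hmix i j
    · change G.Adj (m (d i)) (d j) ↔ i = j
      rw [G.adj_comm, hmix]
      exact eq_comm
    · change G.Adj (m (d i)) (m (d j)) ↔ (i ≠ j ∧ ¬ (j = i + 1 ∨ i = j + 1))
      rw [hGH, hs.invol, or_iff_left fun h => hnm i j h.symm, ← hd.adj_iff]
      constructor
      · intro h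
        exact ⟨fun hij => h.ne (by rw [hij]), fun h' => (hX _ (hdX i)).2.2 _ ⟨h', h⟩⟩
      · rintro ⟨h1, h2⟩
        exact (hadj _ (hdX i) _ (hdX j) (by rwa [ne_eq, hdinj])).resolve_left h2
  let e₁ : Fin 5 × Bool ≃ V := Equiv.ofBijective f hfbij
  let e₂ : Fin 5 × Bool ≃ {s : Finset (Fin 5) // s.card = 2} :=
    Equiv.ofBijective petersenLabel petersenLabel_bijective
  refine ⟨⟨e₁.symm.trans e₂, ?_⟩⟩
  intro a b
  obtain ⟨p, rfl⟩ := e₁.surjective a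
  obtain ⟨q, rfl⟩ := e₁.surjective b
  rw [Equiv.trans_apply, Equiv.trans_apply, Equiv.symm_apply_apply, Equiv.symm_apply_apply]
  exact (petersenLabel_adj p q).trans (hfadj p q).symm

theorem exists_isSplit [Finite V] {G H : SimpleGraph V} (hle : H ≤ G)
    (h3 : ∀ v, (G.neighborSet v).ncard = 3) (h2 : ∀ v, (H.neighborSet v).ncard = 2) :
    ∃ m, IsSplit G H m := by
  have key : ∀ v, ∃ w, ∀ z, z ∈ G.neighborSet v \ H.neighborSet v ↔ z = w := by
    intro v
    have hsub : H.neighborSet v ⊆ G.neighborSet v := fun w hw => hle hw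
    have := Set.ncard_sdiff_add_ncard_of_subset hsub
    rw [h3, h2] at this
    obtain ⟨w, hw⟩ := Set.ncard_eq_one.1 (show (G.neighborSet v \ H.neighborSet v).ncard = 1 by lia)
    exact ⟨w, fun z => by rw [hw, Set.mem_singleton_iff]⟩
  choose m hm using key
  have hm' : ∀ v, G.Adj v (m v) ∧ ¬ H.Adj v (m v) := fun v => (hm v (m v)).2 rfl
  exact ⟨m, ⟨⟨fun v => ((hm (m v) v).1 ⟨(hm' v).1.symm, fun h => (hm' v).2 h.symm⟩).symm,
    fun v => (hm' v).1⟩, hle, fun {u v} h => or_iff_not_imp_left.2 fun h' => (hm u v).1 ⟨h, h'⟩,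
    fun v => (hm' v).2, h2⟩⟩

/-- The theorem with its hypotheses unbundled; only edges of `G` are required not to be bridges,
so `G` may be disconnected. -/
theorem exists_nonConflicting_flow [Fintype V] {G H : SimpleGraph V}
    (hbridge : ∀ u v, G.Adj u v → (G.deleteEdges {s(u, v)}).Reachable u v)
    (h3 : ∀ v, (G.neighborSet v).ncard = 3) (hpet : ¬ Nonempty (G ≃g PetersenGraph))
    (hle : H ≤ G) (h2 : ∀ v, (H.neighborSet v).ncard = 2)
    (hcov : ∀ u v w, H.Reachable u v ∨ H.Reachable u w ∨ H.Reachable v w) :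
    ∃ M : G.Subgraph, M.IsPerfectMatching ∧
      ∃ θ : V → K4, IsNZFlowWrt G M θ ∧ NonConflicting G M θ := by
  obtain ⟨m, hs⟩ := exists_isSplit hle h3 h2
  by_cases heven : ∀ u, ∑ v with H.Reachable u v, (1 : ZMod 2) = 0
  · exact hs.toIsMate.exists_flow_of_even (by rwa [hs.coFactor_eq])
  push Not at heven
  obtain ⟨u, hu⟩ := heven
  have hone : ∀ z : ZMod 2, z ≠ 0 → z = 1 := by decide
  have hodd : ∀ w, ∑ v with H.Reachable w v, (1 : ZMod 2) = 1 := by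
    intro w
    by_cases huw : H.Reachable u w
    · have : ∀ v, H.Reachable w v ↔ H.Reachable u v := fun v =>
        ⟨fun h => huw.trans h, fun h => huw.symm.trans h⟩
      simp only [this]
      exact hone _ hu
    · have : ∀ v, H.Reachable w v ↔ ¬ H.Reachable u v := fun v =>
        ⟨fun h h' => huw (h'.trans h.symm), fun h => ((hcov u w v).resolve_left huw).resolve_left h⟩
      simp only [this]
      have hsum := Finset.sum_filter_add_sum_filter_not Finset.univ
        (fun v => H.Reachable u v) fun _ => (1 : ZMod 2)
      rw [hs.toIsMate.sum_eq_zero fun _ => rfl, hone _ hu] at hsum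
      exact (eq_neg_of_add_eq_zero_right hsum).trans (by decide)
  have hcard := hs.toIsMate.odd_card_crossing (hodd u)
  have hcard1 := hs.card_crossing_ne_one hbridge u
  by_cases h : ∃ x ∈ crossing H m u, ∃ y ∈ crossing H m u,
      x ≠ y ∧ ¬ H.Adj x y ∧ ¬ H.Adj (m x) (m y)
  · obtain ⟨x, hx, y, hy, hxy, h1, h2⟩ := h
    exact hs.exists_flow_of_not_adj hcov hodd hx hy hxy h1 h2
  by_cases hcard3 : (crossing H m u).card = 3
  · exact hs.exists_flow_of_card_crossing_eq_three hcov hodd hcard3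
  refine absurd (hs.nonempty_iso_petersenGraph hcov (u := u) ?_ ?_) hpet
  · obtain ⟨k, hk⟩ := hcard
    lia
  · intro x hx y hy hxy
    by_contra h'
    rw [not_or] at h'
    exact h ⟨x, hx, y, hy, hxy, h'⟩

end NonConflictingFlow

/-- Every bridgeless cubic graph that is not isomorphic to the Petersen graph and contains
a 2-factor with at most two connected components has a perfect matching `M` with respect
to which there is a non-conflicting nowhere-zero `Z2 × Z2` flow. -/
theorem stmt_10 {V : Type} [Fintype V] [DecidableEq V] (G : SimpleGraph V)
    (hbl : G.Bridgeless) (hcubic : G.IsRegularOfDegree 3)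
    (hnotpet : ¬ Nonempty (G ≃g PetersenGraph))
    (h2f : ∃ H : G.Subgraph, H.IsSpanning ∧ (∀ v : V, H.degree v = 2) ∧
      ∃ S : Finset V, S.card ≤ 2 ∧ ∀ v : V, ∃ u ∈ S, H.spanningCoe.Reachable u v) :
    ∃ M : G.Subgraph, M.IsPerfectMatching ∧
      ∃ θ : V → K4, IsNZFlowWrt G M θ ∧ NonConflicting G M θ := by
  obtain ⟨H, hspan, hdeg, S, hS, hSc⟩ := h2f
  refine NonConflictingFlow.exists_nonConflicting_flow (H := H.spanningCoe) (fun u v _ => ?_)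
    (fun v => ?_) hnotpet H.spanningCoe_le (fun v => ?_) fun u v w => ?_
  · have := hbl s(u, v)
    rwa [SimpleGraph.isBridge_iff, not_not] at this
  · rw [Set.ncard_eq_toFinset_card', ← SimpleGraph.neighborFinset_def,
      SimpleGraph.card_neighborFinset_eq_degree]
    exact hcubic v
  · have h := hdeg v
    rw [SimpleGraph.Subgraph.degree, ← Nat.card_eq_fintype_card] at h
    exact h
  · obtain ⟨a, ha, hau⟩ := hSc u
    obtain ⟨b, hb, hbv⟩ := hSc v
    obtain ⟨c, hc, hcw⟩ := hSc w
    by_cases hab : a = b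
    · exact Or.inl (hau.symm.trans (hab ▸ hbv))
    · by_cases hac : a = c
      · exact Or.inr (Or.inl (hau.symm.trans (hac ▸ hcw)))
      · by_cases hbc : b = c
        · exact Or.inr (Or.inr (hbv.symm.trans (hbc ▸ hcw)))
        · have h1 : ({a, b, c} : Finset V) ⊆ S := by
            intro z
            simp only [Finset.mem_insert, Finset.mem_singleton]
            rintro (rfl | rfl | rfl) <;> assumption
          have h2 := Finset.card_le_card h1
          rw [Finset.card_eq_three.2 ⟨a, b, c, hab, hac, hbc, rfl⟩] at h2
          lia
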